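/- arXiv:1901.05329 — 4 statements merged into one kernel-verified Lean document; each statement's English description precedes it below -/
import Mathlib

section
/- Let k ≥ 4 and r, s be fixed positive integers with 0 < r < s < r+s < k. For each positive integer n and each integer m ≥ (r+k)n, let A_n(m) denote the number of partitions of m in which every part belongs to {r} ∪ {s, s+k, s+2k, …, s+(n−1)k} ∪ {k, 2k, 3k, …, nk}, the part r occurs exactly n times, each part from {s, s+k, …, s+(n−1)k} occurs at most once, parts from {k, 2k, …, nk} may repeat, and the part nk occurs at least once. Let B_n(m) denote the number of partitions of m into exactly n parts in which every part is congruent to r+s or to r modulo k, parts congruent to r+s (mod k) are distinct and the part r+s itself does not appear, and parts congruent to r (mod k) may repeat but the part r itself does not appear. Then A_n(m) = B_n(m). -/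
/-- Multisets of natural numbers whose odd elements are not repeated. -/
def OddDistinct (p : Multiset ℕ) : Prop := ∀ x, x % 2 = 1 → p.count x ≤ 1

/-- The weight of a code: `2 * j` stands for `j * k`, and `2 * j + 1` for `s + j * k`. -/
def codeWeight (k s x : ℕ) : ℕ := x / 2 * k + x % 2 * s

/-- Multisets of codes in `[1, 2 * n]` with distinct odd elements. -/
abbrev BoundedCodes (n : ℕ) : Type :=
  {p : Multiset ℕ // (∀ x ∈ p, 1 ≤ x ∧ x ≤ 2 * n) ∧ OddDistinct p}

/-- Multisets of `n` codes with distinct odd elements. -/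
abbrev SizedCodes (n : ℕ) : Type :=
  {p : Multiset ℕ // p.card = n ∧ OddDistinct p}

lemma codeWeight_add_two_mul (k s x c : ℕ) :
    codeWeight k s (x + 2 * c) = codeWeight k s x + c * k := by
  unfold codeWeight
  rw [show (x + 2 * c) / 2 = x / 2 + c by omega, show (x + 2 * c) % 2 = x % 2 by omega]
  ring

lemma sum_map_codeWeight_add (k s c : ℕ) (p : Multiset ℕ) :
    ((p.map (· + 2 * c)).map (codeWeight k s)).sum =
      (p.map (codeWeight k s)).sum + p.card * (c * k) := by
  simp [Multiset.map_map, codeWeight_add_two_mul, Multiset.sum_map_add]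

/-- Adjoin to codes bounded by `2 * n` the new codes `2 * n + 1` and `2 * n + 2`. -/
def extendBounded (n d : ℕ) (a : Multiset ℕ) : Multiset ℕ :=
  a + Multiset.replicate (d / 2) (2 * n + 2) + Multiset.replicate (d % 2) (2 * n + 1)

/-- Adjoin to `p`, suitably shifted, a new least code `d`. -/
def extendSized (d : ℕ) (p : Multiset ℕ) : Multiset ℕ :=
  d ::ₘ p.map (· + 2 * ((d + 1) / 2))

lemma count_extendBounded (n d x : ℕ) (a : Multiset ℕ) :
    (extendBounded n d a).count x = a.count x + (if 2 * n + 2 = x then d / 2 else 0) +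
      (if 2 * n + 1 = x then d % 2 else 0) := by
  simp [extendBounded, Multiset.count_replicate]

lemma extendBounded_mem {n : ℕ} (d : ℕ) (a : BoundedCodes n) :
    (∀ x ∈ extendBounded n d a.1, 1 ≤ x ∧ x ≤ 2 * (n + 1)) ∧
      OddDistinct (extendBounded n d a.1) := by
  obtain ⟨a, ha, hodd⟩ := a
  refine ⟨fun x hx => ?_, fun x hx => ?_⟩
  · simp only [extendBounded, Multiset.mem_add, Multiset.mem_replicate] at hx
    rcases hx with (hx | hx) | hx
    · have := ha x hx
      omega
    · omega
    · omega
  · have h1 := hodd x hx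
    rw [count_extendBounded]
    by_cases hx' : 2 * n + 1 = x
    · have : a.count x = 0 := Multiset.count_eq_zero.2 fun h => by
        have := ha x h
        omega
      simp only [this]
      split_ifs <;> omega
    · split_ifs <;> omega

lemma extendSized_mem {n : ℕ} (d : ℕ) (p : SizedCodes n) :
    (extendSized d p.1).card = n + 1 ∧ OddDistinct (extendSized d p.1) := by
  obtain ⟨p, hp, hodd⟩ := p
  refine ⟨by simp [extendSized, hp], fun x hx => ?_⟩
  have hinj : Function.Injective (· + 2 * ((d + 1) / 2) : ℕ → ℕ) := add_left_injective _
  change (extendSized d p).count x ≤ 1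
  rw [extendSized, Multiset.count_cons]
  by_cases hle : 2 * ((d + 1) / 2) ≤ x
  · obtain ⟨y, rfl⟩ := Nat.exists_eq_add_of_le' hle
    rw [Multiset.count_map_eq_count' _ _ hinj]
    have := hodd y (by omega)
    split_ifs <;> omega
  · have : (p.map (· + 2 * ((d + 1) / 2))).count x = 0 :=
      Multiset.count_eq_zero.2 fun h => by
        obtain ⟨y, -, rfl⟩ := Multiset.mem_map.1 h
        omega
    split_ifs <;> omega

lemma extendBounded_bijective (n : ℕ) : Function.Bijective
    (fun x : ℕ × BoundedCodes n =>
      (⟨extendBounded n x.1 x.2.1, extendBounded_mem x.1 x.2⟩ : BoundedCodes (n + 1))) := by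
  constructor
  · rintro ⟨d, a, ha, hao⟩ ⟨e, b, hb, hbo⟩ h
    have h' : extendBounded n d a = extendBounded n e b := congrArg Subtype.val h
    have hnot : ∀ c : Multiset ℕ, (∀ x ∈ c, 1 ≤ x ∧ x ≤ 2 * n) → ∀ x, 2 * n < x →
        c.count x = 0 := fun c hc x hx => Multiset.count_eq_zero.2 fun hm => by
      have := hc x hm
      omega
    have h1 := congrArg (Multiset.count (2 * n + 1)) h'
    have h2 := congrArg (Multiset.count (2 * n + 2)) h'
    simp only [count_extendBounded, hnot a ha _ (show 2 * n < 2 * n + 1 by omega),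
      hnot a ha _ (show 2 * n < 2 * n + 2 by omega),
      hnot b hb _ (show 2 * n < 2 * n + 1 by omega),
      hnot b hb _ (show 2 * n < 2 * n + 2 by omega)] at h1 h2
    have hde : d = e := by
      simp at h1 h2
      omega
    subst hde
    simp only [extendBounded, add_left_inj] at h'
    simp [h']
  · rintro ⟨q, hq, hodd⟩
    have h1 := hodd (2 * n + 1) (by omega)
    refine ⟨(2 * q.count (2 * n + 2) + q.count (2 * n + 1), ⟨q.filter (· ≤ 2 * n), ?_, ?_⟩), ?_⟩
    · intro x hx
      rw [Multiset.mem_filter] at hx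
      exact ⟨(hq x hx.1).1, hx.2⟩
    · intro x hx
      exact (Multiset.count_le_of_le x (Multiset.filter_le _ _)).trans (hodd x hx)
    · refine Subtype.ext (Multiset.ext.2 fun x => ?_)
      simp only [count_extendBounded, Multiset.count_filter]
      by_cases hx : x ≤ 2 * n
      · rw [if_pos hx, if_neg (by omega), if_neg (by omega)]
        rfl
      · rw [if_neg hx]
        by_cases hx1 : x = 2 * n + 1
        · subst hx1
          simp
          omega
        · by_cases hx2 : x = 2 * n + 2
          · subst hx2
            simp
            omega
          · have : q.count x = 0 := Multiset.count_eq_zero.2 fun h => by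
              have := hq x h
              omega
            rw [this, if_neg (by omega), if_neg (by omega)]

lemma le_of_mem_extendSized {d x : ℕ} {p : Multiset ℕ} (hx : x ∈ extendSized d p) : d ≤ x := by
  simp only [extendSized, Multiset.mem_cons, Multiset.mem_map] at hx
  rcases hx with rfl | ⟨y, -, rfl⟩ <;> omega

lemma extendSized_bijective (n : ℕ) : Function.Bijective
    (fun x : ℕ × SizedCodes n =>
      (⟨extendSized x.1 x.2.1, extendSized_mem x.1 x.2⟩ : SizedCodes (n + 1))) := by
  constructor
  · rintro ⟨d, p, hp, hpo⟩ ⟨e, q, hq, hqo⟩ h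
    have h' : extendSized d p = extendSized e q := congrArg Subtype.val h
    have hde : d = e := le_antisymm
      (le_of_mem_extendSized (p := p) (h' ▸ Multiset.mem_cons_self _ _))
      (le_of_mem_extendSized (p := q) (h' ▸ Multiset.mem_cons_self _ _))
    subst hde
    have := Multiset.map_injective (add_left_injective _) ((Multiset.cons_inj_right _).1 h')
    simp [this]
  · rintro ⟨q, hq, hodd⟩
    have hne : ∃ d, d ∈ q := Multiset.card_pos_iff_exists_mem.1 (by omega)
    classical
    obtain ⟨hd, hmin⟩ := And.intro (Nat.find_spec hne) (fun x => Nat.find_min' hne (m := x))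
    generalize Nat.find hne = d at hd hmin
    obtain ⟨t, rfl⟩ := Multiset.exists_cons_of_mem hd
    have hge : ∀ x ∈ t, 2 * ((d + 1) / 2) ≤ x := by
      intro x hx
      have h1 := hmin x (Multiset.mem_cons_of_mem hx)
      by_cases hdx : d = x
      · subst hdx
        by_contra hlt
        have h2 := hodd d (by omega)
        rw [Multiset.count_cons_self] at h2
        have := Multiset.count_pos.2 hx
        omega
      · omega
    have hmap : (t.map (· - 2 * ((d + 1) / 2))).map (· + 2 * ((d + 1) / 2)) = t := by
      rw [Multiset.map_map]
      conv_rhs => rw [← Multiset.map_id t]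
      exact Multiset.map_congr rfl fun x hx => by simpa using Nat.sub_add_cancel (hge x hx)
    refine ⟨(d, ⟨t.map (· - 2 * ((d + 1) / 2)), by simpa using hq, fun x hx => ?_⟩), ?_⟩
    · rw [← Multiset.count_map_eq_count' _ _ (add_left_injective (2 * ((d + 1) / 2))), hmap]
      exact (Multiset.count_le_count_cons _ _ _).trans (hodd _ (by omega))
    · exact Subtype.ext (congrArg (d ::ₘ ·) hmap)

/-- A weight-preserving bijection between the two families of codes. -/
lemma exists_codes_equiv (k s n : ℕ) : ∃ e : BoundedCodes n ≃ SizedCodes n,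
    ∀ a, ((e a).1.map (codeWeight k s)).sum = (a.1.map (codeWeight k s)).sum := by
  induction n with
  | zero =>
    have hb (a : BoundedCodes 0) : a.1 = 0 := Multiset.eq_zero_of_forall_notMem fun x hx => by
      have := a.2.1 x hx
      omega
    have hs (p : SizedCodes 0) : p.1 = 0 := Multiset.card_eq_zero.1 p.2.1
    refine ⟨⟨fun _ => ⟨0, by simp [OddDistinct]⟩, fun _ => ⟨0, by simp [OddDistinct]⟩,
      fun a => Subtype.ext (hb a).symm, fun p => Subtype.ext (hs p).symm⟩, fun a => ?_⟩
    simp [hb a]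
  | succ n ih =>
    obtain ⟨e, he⟩ := ih
    let f := Equiv.ofBijective _ (extendBounded_bijective n)
    refine ⟨f.symm.trans (((Equiv.refl ℕ).prodCongr e).trans
      (Equiv.ofBijective _ (extendSized_bijective n))), fun a => ?_⟩
    obtain ⟨⟨d, a⟩, rfl⟩ := f.surjective a
    simp only [Equiv.trans_apply, Equiv.symm_apply_apply]
    change ((extendSized d (e a).1).map (codeWeight k s)).sum =
      ((extendBounded n d a.1).map (codeWeight k s)).sum
    rw [extendSized, Multiset.map_cons, Multiset.sum_cons, sum_map_codeWeight_add, he,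
      (e a).2.1, extendBounded]
    simp only [Multiset.map_add, Multiset.map_replicate, Multiset.sum_add,
      Multiset.sum_replicate, smul_eq_mul]
    unfold codeWeight
    rw [show (2 * n + 2) / 2 = n + 1 by omega, show (2 * n + 2) % 2 = 0 by omega,
      show (2 * n + 1) / 2 = n by omega, show (2 * n + 1) % 2 = 1 by omega,
      show (d + 1) / 2 = d / 2 + d % 2 by omega]
    ring

/-- The code of a number congruent to `0` or `s` modulo `k`. -/
def codeOf (k y : ℕ) : ℕ := 2 * (y / k) + if y % k = 0 then 0 else 1

lemma codeOf_codeWeight {k s : ℕ} (hs : 0 < s) (hsk : s < k) (x : ℕ) :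
    codeOf k (codeWeight k s x) = x := by
  unfold codeOf codeWeight
  have hk : 0 < k := by omega
  rcases Nat.mod_two_eq_zero_or_one x with h | h
  · rw [h, zero_mul, add_zero, Nat.mul_div_cancel _ hk, Nat.mul_mod_left, if_pos rfl]
    omega
  · rw [h, one_mul, Nat.mul_add_mod_of_lt hsk, if_neg hs.ne', add_comm (x / 2 * k),
      Nat.add_mul_div_right _ _ hk, Nat.div_eq_of_lt hsk]
    omega

lemma codeWeight_mod {k s : ℕ} (hsk : s < k) (x : ℕ) :
    codeWeight k s x % k = x % 2 * s := by
  unfold codeWeight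
  apply Nat.mul_add_mod_of_lt
  rcases Nat.mod_two_eq_zero_or_one x with h | h <;> rw [h] <;> omega

lemma codeWeight_codeOf {k s y : ℕ} (hs : 0 < s) (hy : y % k = 0 ∨ y % k = s) :
    codeWeight k s (codeOf k y) = y := by
  unfold codeOf codeWeight
  have := Nat.div_add_mod' y k
  rcases hy with h | h
  · rw [if_pos h, show (2 * (y / k) + 0) / 2 = y / k by omega,
      show (2 * (y / k) + 0) % 2 = 0 by omega]
    omega
  · rw [if_neg (by omega), show (2 * (y / k) + 1) / 2 = y / k by omega,
      show (2 * (y / k) + 1) % 2 = 1 by omega]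
    omega

lemma codeWeight_injective {k s : ℕ} (hs : 0 < s) (hsk : s < k) :
    Function.Injective (codeWeight k s) :=
  Function.LeftInverse.injective (codeOf_codeWeight hs hsk)

lemma codeWeight_pos {k s x : ℕ} (hs : 0 < s) (hsk : s < k) (hx : 0 < x) :
    0 < codeWeight k s x := by
  have h : codeWeight k s 0 = 0 := by simp [codeWeight]
  have := (codeWeight_injective hs hsk).ne hx.ne'
  omega

/-- The partition into `n` parts `r`, one part `n * k` and the weights of the codes in `q` has the
shape counted by `A`. -/
lemma card_partitions_eq_card_boundedCodes {k r s n m : ℕ} (hr : 0 < r) (hrs : r < s) (hsk : s < k)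
    (hn : 0 < n) :
    Nat.card {p : Nat.Partition m //
      (∀ x ∈ p.parts, x = r ∨ (∃ i < n, x = s + i * k) ∨ (∃ i, 1 ≤ i ∧ i ≤ n ∧ x = i * k)) ∧
      p.parts.count r = n ∧
      (∀ i < n, p.parts.count (s + i * k) ≤ 1) ∧
      n * k ∈ p.parts} =
    Nat.card {q : BoundedCodes n // (q.1.map (codeWeight k s)).sum + (r + k) * n = m} := by
  have hs : 0 < s := by omega
  have hinj := codeWeight_injective hs hsk
  have hmod_r : r % k = r := Nat.mod_eq_of_lt (by omega)
  have hmod_s (i : ℕ) : (s + i * k) % k = s := by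
    rw [Nat.add_mul_mod_self_right, Nat.mod_eq_of_lt hsk]
  have hmod_mul (i : ℕ) : i * k % k = 0 := Nat.mul_mod_left _ _
  have hw_odd (i : ℕ) : codeWeight k s (2 * i + 1) = s + i * k := by
    unfold codeWeight
    rw [show (2 * i + 1) / 2 = i by omega, show (2 * i + 1) % 2 = 1 by omega]
    ring
  have hw_even (i : ℕ) : codeWeight k s (2 * i) = i * k := by
    unfold codeWeight
    rw [show (2 * i) / 2 = i by omega, show (2 * i) % 2 = 0 by omega]
    ring
  have hr_notMem (q : Multiset ℕ) : r ∉ q.map (codeWeight k s) := fun h => by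
    obtain ⟨x, -, hx⟩ := Multiset.mem_map.1 h
    have h1 := codeWeight_mod hsk x
    rw [hx, hmod_r] at h1
    rcases Nat.mod_two_eq_zero_or_one x with h | h <;> rw [h] at h1 <;> omega
  have hr_ne (i : ℕ) : i * k ≠ r := fun h => by
    have := hmod_mul i
    rw [h] at this
    omega
  have hs_ne (i j : ℕ) : s + i * k ≠ j * k := fun h => by
    have h1 := hmod_s i
    have h2 := hmod_mul j
    rw [h] at h1
    omega
  have hs_ne_r (i : ℕ) : s + i * k ≠ r := by omega
  symm
  refine Nat.card_congr (Equiv.ofBijective (fun q =>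
    ⟨⟨Multiset.replicate n r + n * k ::ₘ q.1.1.map (codeWeight k s), ?_, ?_⟩,
      ?_, ?_, ?_, ?_⟩) ⟨?_, ?_⟩)
  · intro y hy
    simp only [Multiset.mem_add, Multiset.mem_replicate, Multiset.mem_cons, Multiset.mem_map] at hy
    rcases hy with ⟨-, rfl⟩ | rfl | ⟨x, hx, rfl⟩
    · exact hr
    · exact Nat.mul_pos hn (by omega)
    · exact codeWeight_pos hs hsk (q.1.2.1 x hx).1
  · have := q.2
    simp only [Multiset.sum_add, Multiset.sum_replicate, Multiset.sum_cons, smul_eq_mul]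
    linarith
  · intro y hy
    simp only [Multiset.mem_add, Multiset.mem_replicate, Multiset.mem_cons, Multiset.mem_map] at hy
    rcases hy with ⟨-, rfl⟩ | rfl | ⟨x, hx, rfl⟩
    · exact Or.inl rfl
    · exact Or.inr (Or.inr ⟨n, hn, le_rfl, rfl⟩)
    · have := q.1.2.1 x hx
      obtain ⟨i, rfl | rfl⟩ := Nat.even_or_odd' x
      · exact Or.inr (Or.inr ⟨i, by omega, by omega, hw_even i⟩)
      · exact Or.inr (Or.inl ⟨i, by omega, hw_odd i⟩)
  · rw [Multiset.count_add, Multiset.count_replicate_self, Multiset.count_cons_of_ne (hr_ne n).symm,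
      Multiset.count_eq_zero.2 (hr_notMem _), add_zero]
  · intro i hi
    rw [Multiset.count_add, Multiset.count_replicate, if_neg (hs_ne_r i).symm,
      Multiset.count_cons_of_ne (hs_ne i n), ← hw_odd, Multiset.count_map_eq_count' _ _ hinj,
      zero_add]
    exact q.1.2.2 _ (by omega)
  · simp
  · intro q q' h
    have h' := congrArg (fun p => p.1.parts) h
    simp only [add_right_inj, Multiset.cons_inj_right] at h'
    exact Subtype.ext (Subtype.ext (Multiset.map_injective hinj h'))
  · rintro ⟨⟨p, hp0, hpm⟩, hp, hpr, hps, hpn⟩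
    dsimp only at hp hpr hps hpn
    obtain ⟨u, rfl⟩ := Multiset.le_iff_exists_add.1 (Multiset.le_count_iff_replicate_le.1 hpr.ge)
    have hru : r ∉ u := by
      rw [Multiset.count_add, Multiset.count_replicate_self] at hpr
      exact Multiset.count_eq_zero.1 (by omega)
    have hnu : n * k ∈ u := (Multiset.mem_add.1 hpn).resolve_left fun h =>
      hr_ne n (Multiset.eq_of_mem_replicate h)
    obtain ⟨t, rfl⟩ := Multiset.exists_cons_of_mem hnu
    have hcode : ∀ y ∈ t, ∃ x, (1 ≤ x ∧ x ≤ 2 * n) ∧ codeWeight k s x = y := by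
      intro y hy
      have hyu := Multiset.mem_cons_of_mem (b := n * k) hy
      rcases hp y (Multiset.mem_add.2 (Or.inr hyu)) with rfl | ⟨i, hi, rfl⟩ | ⟨i, hi, hi', rfl⟩
      · exact absurd hyu hru
      · exact ⟨2 * i + 1, by omega, hw_odd i⟩
      · exact ⟨2 * i, by omega, hw_even i⟩
    have hmap : (t.map (codeOf k)).map (codeWeight k s) = t := by
      rw [Multiset.map_map]
      conv_rhs => rw [← Multiset.map_id t]
      refine Multiset.map_congr rfl fun y hy => ?_
      obtain ⟨x, -, rfl⟩ := hcode y hy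
      simp [codeOf_codeWeight hs hsk]
    have hbdd : ∀ x ∈ t.map (codeOf k), 1 ≤ x ∧ x ≤ 2 * n := by
      intro x hx
      obtain ⟨y, hy, rfl⟩ := Multiset.mem_map.1 hx
      obtain ⟨x, hx', rfl⟩ := hcode y hy
      rwa [codeOf_codeWeight hs hsk]
    refine ⟨⟨⟨t.map (codeOf k), hbdd, fun x hx => ?_⟩, ?_⟩, ?_⟩
    · by_cases hmem : x ∈ t.map (codeOf k)
      · have := hbdd x hmem
        obtain ⟨i, rfl | rfl⟩ := Nat.even_or_odd' x
        · omega
        · have := hps i (by omega)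
          rw [Multiset.count_add, Multiset.count_cons] at this
          rw [← Multiset.count_map_eq_count' _ _ hinj, hmap, hw_odd]
          omega
      · rw [Multiset.count_eq_zero.2 hmem]
        omega
    · simp only [Multiset.sum_add, Multiset.sum_replicate, Multiset.sum_cons, smul_eq_mul] at hpm
      rw [hmap]
      linarith
    · simp only [hmap]

/-- The partition into the weights of the codes in `q`, each increased by `r + k`, has the shape
counted by `B`. -/
lemma card_partitions_eq_card_sizedCodes {k r s n m : ℕ} (hr : 0 < r) (hs : 0 < s)
    (hrsk : r + s < k) :
    Nat.card {p : Nat.Partition m //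
      p.parts.card = n ∧
      (∀ x ∈ p.parts, x % k = r + s ∨ x % k = r) ∧
      (∀ x ∈ p.parts, x % k = r + s → p.parts.count x ≤ 1) ∧
      r + s ∉ p.parts ∧
      r ∉ p.parts} =
    Nat.card {q : SizedCodes n // (q.1.map (codeWeight k s)).sum + (r + k) * n = m} := by
  have hsk : s < k := by omega
  have hinj : Function.Injective (fun x => codeWeight k s x + (r + k)) :=
    (add_left_injective (r + k)).comp (codeWeight_injective hs hsk)
  have hmod (x : ℕ) : (codeWeight k s x + (r + k)) % k = x % 2 * s + r := by
    rw [← add_assoc, Nat.add_mod_right, Nat.add_mod, codeWeight_mod hsk,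
      Nat.mod_eq_of_lt (show r < k by omega), Nat.mod_eq_of_lt]
    rcases Nat.mod_two_eq_zero_or_one x with h | h <;> rw [h] <;> omega
  symm
  refine Nat.card_congr (Equiv.ofBijective (fun q =>
    ⟨⟨q.1.1.map (fun x => codeWeight k s x + (r + k)), ?_, ?_⟩, ?_, ?_, ?_, ?_, ?_⟩) ⟨?_, ?_⟩)
  · intro y hy
    obtain ⟨x, -, rfl⟩ := Multiset.mem_map.1 hy
    omega
  · have := q.2
    rw [Multiset.sum_map_add, Multiset.map_const', Multiset.sum_replicate, smul_eq_mul, q.1.2.1]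
    linarith
  · simpa using q.1.2.1
  · intro y hy
    obtain ⟨x, -, rfl⟩ := Multiset.mem_map.1 hy
    rw [hmod]
    rcases Nat.mod_two_eq_zero_or_one x with h | h <;> rw [h] <;> omega
  · intro y hy hyk
    obtain ⟨x, -, rfl⟩ := Multiset.mem_map.1 hy
    rw [hmod] at hyk
    rw [Multiset.count_map_eq_count' _ _ hinj]
    refine q.1.2.2 x ?_
    rcases Nat.mod_two_eq_zero_or_one x with h | h
    · rw [h] at hyk
      omega
    · exact h
  · intro hy
    obtain ⟨x, -, hx⟩ := Multiset.mem_map.1 hy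
    omega
  · intro hy
    obtain ⟨x, -, hx⟩ := Multiset.mem_map.1 hy
    omega
  · intro q q' h
    have h' := congrArg (fun p => p.1.parts) h
    exact Subtype.ext (Subtype.ext (Multiset.map_injective hinj h'))
  · rintro ⟨⟨p, hp0, hpm⟩, hpn, hp, hpc, hprs, hpr⟩
    dsimp only at hpn hp hpc hprs hpr
    have hmap : (p.map fun y => codeOf k (y - (r + k))).map
        (fun x => codeWeight k s x + (r + k)) = p := by
      rw [Multiset.map_map]
      conv_rhs => rw [← Multiset.map_id p]
      refine Multiset.map_congr rfl fun y hy => ?_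
      have hyk := hp y hy
      have hle : r + k ≤ y := by
        have hdiv := Nat.div_add_mod' y k
        have h0 : y / k ≠ 0 := fun h0 => by
          rw [h0, zero_mul, zero_add] at hdiv
          rw [hdiv] at hyk
          rcases hyk with rfl | rfl
          · exact hprs hy
          · exact hpr hy
        have := Nat.le_mul_of_pos_left k (Nat.pos_of_ne_zero h0)
        omega
      obtain ⟨z, rfl⟩ := Nat.exists_eq_add_of_le' hle
      have hz : z % k = 0 ∨ z % k = s := by
        rw [← add_assoc, Nat.add_mod_right] at hyk
        have h1 : (z + r) % k = (z % k + r) % k := by simp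
        have h2 := Nat.mod_lt z (show 0 < k by omega)
        rw [h1] at hyk
        by_cases h3 : z % k + r < k
        · rw [Nat.mod_eq_of_lt h3] at hyk
          omega
        · rw [Nat.mod_eq_sub_mod (by omega), Nat.mod_eq_of_lt (by omega)] at hyk
          omega
      simp [codeWeight_codeOf hs hz]
    refine ⟨⟨⟨p.map fun y => codeOf k (y - (r + k)), by simpa using hpn, fun x hx => ?_⟩, ?_⟩, ?_⟩
    · rw [← Multiset.count_map_eq_count' _ _ hinj, hmap]
      by_cases hmem : codeWeight k s x + (r + k) ∈ p
      · refine hpc _ hmem ?_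
        rw [hmod, hx]
        omega
      · rw [Multiset.count_eq_zero.2 hmem]
        omega
    · have := congrArg Multiset.sum hmap
      rw [Multiset.sum_map_add, Multiset.map_const', Multiset.sum_replicate, smul_eq_mul,
        Multiset.card_map, hpn, hpm] at this
      linarith
    · simp only [hmap]


/-- For `k ≥ 4`, `0 < r < s < r+s < k`, `n` a positive integer and
`m ≥ (r+k)n`, the number of partitions of `m` counted by `A_n(m)` equals the
number counted by `B_n(m)`. -/
theorem partition_A_eq_B (k r s n m : ℕ) (hk : 4 ≤ k) (hr : 0 < r) (hrs : r < s)
    (hsrs : s < r + s) (hrsk : r + s < k) (hn : 0 < n) (hm : (r + k) * n ≤ m) :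
    Nat.card {p : Nat.Partition m //
      (∀ x ∈ p.parts, x = r ∨ (∃ i < n, x = s + i * k) ∨ (∃ i, 1 ≤ i ∧ i ≤ n ∧ x = i * k)) ∧
      p.parts.count r = n ∧
      (∀ i < n, p.parts.count (s + i * k) ≤ 1) ∧
      n * k ∈ p.parts} =
    Nat.card {p : Nat.Partition m //
      p.parts.card = n ∧
      (∀ x ∈ p.parts, x % k = r + s ∨ x % k = r) ∧
      (∀ x ∈ p.parts, x % k = r + s → p.parts.count x ≤ 1) ∧
      r + s ∉ p.parts ∧
      r ∉ p.parts} := by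
  obtain ⟨e, he⟩ := exists_codes_equiv k s n
  rw [card_partitions_eq_card_boundedCodes hr hrs (by omega) hn,
    card_partitions_eq_card_sizedCodes hr (by omega) hrsk]
  exact Nat.card_congr (e.subtypeEquiv fun a => by rw [he])
end

section
/- (q-Binomial Theorem) Let a, z and q be complex numbers with |z| < 1 and |q| < 1. Then ∑_{n=0}^{∞} (a; q)_n z^n / (q; q)_n = (az; q)_∞ / (z; q)_∞. -/
/-- The finite q-Pochhammer symbol `(a; q)_n = ∏_{j=0}^{n-1} (1 - a q^j)`. -/
noncomputable def qPoch (a q : ℂ) (n : ℕ) : ℂ := ∏ j ∈ Finset.range n, (1 - a * q ^ j)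

/-- The infinite q-Pochhammer symbol `(a; q)_∞ = ∏_{j=0}^{∞} (1 - a q^j)`. -/
noncomputable def qPochInf (a q : ℂ) : ℂ := ∏' j : ℕ, (1 - a * q ^ j)

open Filter Topology

lemma summable_norm_neg_mul_pow (a : ℂ) {q : ℂ} (hq : ‖q‖ < 1) :
    Summable fun j : ℕ => ‖-(a * q ^ j)‖ := by
  simpa [norm_mul, norm_pow] using
    (summable_geometric_of_lt_one (norm_nonneg q) hq).mul_left ‖a‖

lemma tendsto_qPoch (a : ℂ) {q : ℂ} (hq : ‖q‖ < 1) :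
    Tendsto (qPoch a q) atTop (𝓝 (qPochInf a q)) := by
  have h := (multipliable_one_add_of_summable
    (summable_norm_neg_mul_pow a hq)).hasProd.tendsto_prod_nat
  simpa only [← sub_eq_add_neg] using! h

lemma one_sub_mul_pow_ne_zero {z q : ℂ} (hz : ‖z‖ < 1) (hq : ‖q‖ < 1) (j : ℕ) :
    1 - z * q ^ j ≠ 0 := by
  intro h
  have h1 : ‖z * q ^ j‖ = 1 := by rw [← sub_eq_zero.mp h, norm_one]
  rw [norm_mul, norm_pow] at h1
  have h2 : ‖q‖ ^ j ≤ 1 := pow_le_one₀ (norm_nonneg q) hq.le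
  nlinarith [norm_nonneg z]

lemma qPochInf_ne_zero {z q : ℂ} (hz : ‖z‖ < 1) (hq : ‖q‖ < 1) : qPochInf z q ≠ 0 := by
  have h := tprod_one_add_ne_zero_of_summable (f := fun j : ℕ => -(z * q ^ j))
    (fun j => by simpa only [← sub_eq_add_neg] using one_sub_mul_pow_ne_zero hz hq j)
    (summable_norm_neg_mul_pow z hq)
  simpa only [← sub_eq_add_neg] using! h

lemma qPoch_succ (a q : ℂ) (n : ℕ) : qPoch a q (n + 1) = qPoch a q n * (1 - a * q ^ n) :=
  Finset.prod_range_succ _ _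

/-- The coefficients of the `q`-binomial series are bounded. -/
lemma exists_norm_qPoch_div_le (a : ℂ) {q : ℂ} (hq : ‖q‖ < 1) :
    ∃ C : ℝ, ∀ n, ‖qPoch a q n / qPoch q q n‖ ≤ C := by
  have h := ((tendsto_qPoch a hq).div (tendsto_qPoch q hq) (qPochInf_ne_zero hq hq)).norm
  obtain ⟨C, hC⟩ := h.bddAbove_range
  exact ⟨C, fun n => hC ⟨n, rfl⟩⟩

lemma summable_qPoch_div_mul_pow (a : ℂ) {z q : ℂ} (hz : ‖z‖ < 1) (hq : ‖q‖ < 1) :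
    Summable fun n : ℕ => qPoch a q n / qPoch q q n * z ^ n := by
  obtain ⟨C, hC⟩ := exists_norm_qPoch_div_le a hq
  refine .of_norm_bounded ((summable_geometric_of_lt_one (norm_nonneg z) hz).mul_left C) fun n => ?_
  rw [norm_mul, norm_pow]
  gcongr
  exact hC n

lemma norm_mul_pow_lt_one {z q : ℂ} (hz : ‖z‖ < 1) (hq : ‖q‖ < 1) (n : ℕ) : ‖z * q ^ n‖ < 1 := by
  rw [norm_mul, norm_pow]
  exact mul_lt_one_of_nonneg_of_lt_one_left (norm_nonneg z) hz
    (pow_le_one₀ (norm_nonneg q) hq.le)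

/-- The functional equation `(1 - z) F(z) = (1 - a z) F(z q)` of the `q`-binomial series. -/
lemma one_sub_mul_tsum_qPoch (a : ℂ) {z q : ℂ} (hz : ‖z‖ < 1) (hq : ‖q‖ < 1) :
    (1 - z) * ∑' n : ℕ, qPoch a q n / qPoch q q n * z ^ n =
      (1 - a * z) * ∑' n : ℕ, qPoch a q n / qPoch q q n * (z * q) ^ n := by
  have hzq : ‖z * q‖ < 1 := by simpa using norm_mul_pow_lt_one hz hq 1
  have h1 := summable_qPoch_div_mul_pow a hz hq
  have h2 := summable_qPoch_div_mul_pow a hzq hq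
  have key : (∑' n : ℕ, qPoch a q n / qPoch q q n * z ^ n) -
      ∑' n : ℕ, qPoch a q n / qPoch q q n * (z * q) ^ n =
      z * (∑' n : ℕ, qPoch a q n / qPoch q q n * z ^ n) -
      a * z * ∑' n : ℕ, qPoch a q n / qPoch q q n * (z * q) ^ n := by
    rw [← h1.tsum_sub h2, (h1.sub h2).tsum_eq_zero_add, ← tsum_mul_left, ← tsum_mul_left,
      ← (h1.mul_left z).tsum_sub (h2.mul_left (a * z))]
    simp only [pow_zero, sub_self, zero_add]
    refine tsum_congr fun n => ?_
    have hn' := one_sub_mul_pow_ne_zero hq hq n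
    have hrec : qPoch a q (n + 1) / qPoch q q (n + 1) * (1 - q * q ^ n) =
        qPoch a q n / qPoch q q n * (1 - a * q ^ n) := by
      rw [qPoch_succ, qPoch_succ, ← div_div, div_mul_cancel₀ _ hn', mul_div_right_comm]
    rw [mul_pow, mul_pow, pow_succ z, pow_succ q]
    linear_combination z ^ n * z * hrec
  linear_combination key

lemma qPoch_mul_tsum_qPoch (a : ℂ) {z q : ℂ} (hz : ‖z‖ < 1) (hq : ‖q‖ < 1) (N : ℕ) :
    qPoch z q N * ∑' n : ℕ, qPoch a q n / qPoch q q n * z ^ n =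
      qPoch (a * z) q N * ∑' n : ℕ, qPoch a q n / qPoch q q n * (z * q ^ N) ^ n := by
  induction N with
  | zero => simp [qPoch]
  | succ N ih =>
    have h := one_sub_mul_tsum_qPoch a (norm_mul_pow_lt_one hz hq N) hq
    rw [mul_assoc z, ← pow_succ] at h
    rw [qPoch_succ, qPoch_succ]
    linear_combination (1 - z * q ^ N) * ih + qPoch (a * z) q N * h

lemma tendsto_tsum_qPoch_mul_pow (a : ℂ) {z q : ℂ} (hz : ‖z‖ < 1) (hq : ‖q‖ < 1) :
    Tendsto (fun N : ℕ => ∑' n : ℕ, qPoch a q n / qPoch q q n * (z * q ^ N) ^ n)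
      atTop (𝓝 1) := by
  obtain ⟨C, hC⟩ := exists_norm_qPoch_div_le a hq
  have hlim : ∑' n : ℕ, qPoch a q n / qPoch q q n * (0 : ℂ) ^ n = 1 := by
    rw [tsum_eq_single 0 fun n hn => by simp [hn]]
    simp [qPoch]
  rw [← hlim]
  refine tendsto_tsum_of_dominated_convergence
    ((summable_geometric_of_lt_one (norm_nonneg z) hz).mul_left C) (fun n => ?_)
    (Eventually.of_forall fun N n => ?_)
  · have h0 : Tendsto (fun N : ℕ => z * q ^ N) atTop (𝓝 0) := by
      simpa using (tendsto_pow_atTop_nhds_zero_of_norm_lt_one hq).const_mul z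
    exact (h0.pow n).const_mul _
  · rw [norm_mul, norm_pow]
    have hle : ‖z * q ^ N‖ ≤ ‖z‖ := by
      rw [norm_mul, norm_pow]
      exact mul_le_of_le_one_right (norm_nonneg z) (pow_le_one₀ (norm_nonneg q) hq.le)
    have hC0 : 0 ≤ C := (norm_nonneg _).trans (hC n)
    gcongr
    exact hC n

/-- q-Binomial Theorem: for complex `a`, `z`, `q` with `|z| < 1`
and `|q| < 1`, `∑_{n≥0} (a; q)_n z^n / (q; q)_n = (az; q)_∞ / (z; q)_∞`. -/
theorem q_binomial_theorem (a z q : ℂ) (hz : ‖z‖ < 1) (hq : ‖q‖ < 1) :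
    ∑' n : ℕ, qPoch a q n * z ^ n / qPoch q q n =
      qPochInf (a * z) q / qPochInf z q := by
  simp only [mul_div_right_comm]
  rw [eq_div_iff (qPochInf_ne_zero hz hq), mul_comm]
  refine tendsto_nhds_unique ((tendsto_qPoch z hq).mul_const _) ?_
  simpa only [qPoch_mul_tsum_qPoch a hz hq, mul_one] using
    (tendsto_qPoch (a * z) hq).mul (tendsto_tsum_qPoch_mul_pow a hz hq)
end

section
/- Let q be a complex number with 0 < |q| < 1 and let b be a complex number with 1 + b q^N ≠ 0 for every positive integer N. Then for all positive integers m and n, the absolutely convergent sum over all n-tuples (a_1, …, a_n) of nonnegative integers with a_1 ≤ a_2 ≤ ⋯ ≤ a_n of q^{m(a_1 + a_2 + ⋯ + a_n)} / ∏_{j=1}^{n} ∏_{k=1}^{m+1} (1 + b q^{(j−1)(m+1) + k + a_j}) equals 1 / ((q^m; q^m)_n · (−bq; q)_{mn}). -/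
/-- Splitting a weakly increasing `(n+1)`-tuple into its first entry and the weakly increasing
`n`-tuple of the differences of the remaining entries with the first one. -/
def monotoneTupleConsEquiv (n : ℕ) :
    ℕ × {a : Fin n → ℕ // Monotone a} ≃ {a : Fin (n + 1) → ℕ // Monotone a} where
  toFun p := ⟨Fin.cons p.1 (fun j => p.1 + p.2.1 j), by
    intro i j hij
    induction i using Fin.cases with
    | zero => induction j using Fin.cases <;> simp
    | succ i =>
      induction j using Fin.cases with
      | zero => simp at hij
      | succ j => simpa using p.2.2 (Fin.succ_le_succ_iff.mp hij)⟩
  invFun a := (a.1 0, ⟨fun j => a.1 j.succ - a.1 0, fun _ _ hij =>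
    Nat.sub_le_sub_right (a.2 (Fin.succ_le_succ_iff.mpr hij)) _⟩)
  left_inv p := by
    ext <;> simp
  right_inv a := by
    ext j
    induction j using Fin.cases with
    | zero => simp
    | succ j => simpa using Nat.add_sub_cancel' (a.2 (Fin.zero_le j.succ))

theorem sum_monotoneTupleConsEquiv (n : ℕ) (p : ℕ × {a : Fin n → ℕ // Monotone a}) :
    ∑ j, (monotoneTupleConsEquiv n p).1 j = (n + 1) * p.1 + ∑ j, p.2.1 j := by
  simp [monotoneTupleConsEquiv, Fin.sum_univ_succ, Finset.sum_add_distrib]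
  ring

theorem summable_pow_sum_monotone {r : ℝ} (h0 : 0 ≤ r) (h1 : r < 1) (n : ℕ) :
    Summable (fun a : {a : Fin n → ℕ // Monotone a} => r ^ ∑ j, a.1 j) := by
  induction n with
  | zero => exact Summable.of_finite
  | succ n ih =>
    rw [← (monotoneTupleConsEquiv n).summable_iff]
    have hg : Summable (fun i : ℕ => (r ^ (n + 1)) ^ i) :=
      summable_geometric_of_lt_one (by positivity) (pow_lt_one₀ h0 h1 (by omega))
    refine (hg.mul_of_nonneg ih (fun _ => by positivity) (fun _ => by positivity)).congr ?_
    intro p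
    simp only [Function.comp, sum_monotoneTupleConsEquiv, pow_add, pow_mul]

theorem exists_norm_inv_one_add_mul_pow_le {q b : ℂ} (hq1 : ‖q‖ < 1) :
    ∃ C : ℝ, ∀ N : ℕ, ‖(1 + b * q ^ N)⁻¹‖ ≤ C := by
  have h : Filter.Tendsto (fun N : ℕ => (1 + b * q ^ N)⁻¹) Filter.atTop (nhds 1) := by
    have := ((tendsto_pow_atTop_nhds_zero_of_norm_lt_one hq1).const_mul b).const_add 1
    simpa using this.inv₀ (by simp)
  obtain ⟨C, hC⟩ := (Metric.isBounded_range_of_tendsto _ h).exists_norm_le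
  exact ⟨C, fun N => hC _ ⟨N, rfl⟩⟩

/-- The summand attached to an `n`-tuple `a`. -/
noncomputable def tupleTerm (q b : ℂ) (m n : ℕ) (a : Fin n → ℕ) : ℂ :=
  q ^ (m * ∑ j, a j) /
    ∏ j : Fin n, ∏ k ∈ Finset.Icc 1 (m + 1), (1 + b * q ^ ((j : ℕ) * (m + 1) + k + a j))

theorem summable_tupleTerm {q : ℂ} (b : ℂ) (hq1 : ‖q‖ < 1) {m : ℕ} (hm : 0 < m) (n : ℕ) :
    Summable (fun a : {a : Fin n → ℕ // Monotone a} => tupleTerm q b m n a.1) := by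
  obtain ⟨C, hC⟩ := exists_norm_inv_one_add_mul_pow_le (b := b) hq1
  have hs := summable_pow_sum_monotone (r := ‖q‖ ^ m) (by positivity)
    (pow_lt_one₀ (norm_nonneg q) hq1 hm.ne') n
  refine Summable.of_norm_bounded
    (hs.mul_right (∏ _j : Fin n, ∏ _k ∈ Finset.Icc 1 (m + 1), C)) fun a => ?_
  rw [tupleTerm, div_eq_mul_inv, norm_mul, norm_pow, pow_mul]
  refine mul_le_mul_of_nonneg_left ?_ (by positivity)
  rw [← Finset.prod_inv_distrib, norm_prod]
  refine Finset.prod_le_prod (fun _ _ => norm_nonneg _) fun j _ => ?_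
  rw [← Finset.prod_inv_distrib, norm_prod]
  exact Finset.prod_le_prod (fun _ _ => norm_nonneg _) fun k _ => hC _

theorem prod_Icc_one_eq_prod_range {M : Type*} [CommMonoid M] (f : ℕ → M) (n : ℕ) :
    ∏ k ∈ Finset.Icc 1 n, f k = ∏ k ∈ Finset.range n, f (k + 1) := by
  rw [Finset.range_eq_Ico, Finset.prod_Ico_add' f 0 n 1]
  rfl

theorem qPoch_neg_mul (q b : ℂ) (n : ℕ) :
    qPoch (-(b * q)) q n = ∏ k ∈ Finset.range n, (1 + b * q ^ (k + 1)) :=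
  Finset.prod_congr rfl fun k _ => by ring

theorem tupleTerm_cons (q b : ℂ) (m n : ℕ) (p : ℕ × {a : Fin n → ℕ // Monotone a}) :
    tupleTerm q b m (n + 1) (monotoneTupleConsEquiv n p).1 =
      q ^ (m * (n + 1) * p.1) / (∏ k ∈ Finset.range (m + 1), (1 + b * q ^ p.1 * q ^ (k + 1))) *
        tupleTerm q (b * q ^ (p.1 + (m + 1))) m n p.2.1 := by
  rw [tupleTerm, tupleTerm, sum_monotoneTupleConsEquiv, div_mul_div_comm, Fin.prod_univ_succ,
    prod_Icc_one_eq_prod_range]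
  congr 1
  · ring
  · congr 1
    · refine Finset.prod_congr rfl fun k _ => ?_
      simp [monotoneTupleConsEquiv]
      ring
    · refine Finset.prod_congr rfl fun j _ => Finset.prod_congr rfl fun k _ => ?_
      simp [monotoneTupleConsEquiv]
      ring

theorem one_add_mul_pow_mul_pow_ne_zero {q b : ℂ} (hb : ∀ N : ℕ, 0 < N → 1 + b * q ^ N ≠ 0)
    (a : ℕ) {N : ℕ} (hN : 0 < N) : 1 + b * q ^ a * q ^ N ≠ 0 := by
  rw [mul_assoc, ← pow_add]
  exact hb _ (by omega)

/-- The telescoping sum `∑ q^{ma} / ∏_{k=1}^{m+1} (1 + b q^{a+k})`. -/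
theorem hasSum_pow_div_prod {q b : ℂ} (hq1 : ‖q‖ < 1)
    (hb : ∀ N : ℕ, 0 < N → 1 + b * q ^ N ≠ 0) {m : ℕ} (hm : 0 < m) :
    HasSum (fun a : ℕ =>
        q ^ (m * a) / ∏ k ∈ Finset.range (m + 1), (1 + b * q ^ a * q ^ (k + 1)))
      (1 / ((1 - q ^ m) * ∏ k ∈ Finset.range m, (1 + b * q ^ (k + 1)))) := by
  set g : ℕ → ℂ := fun a =>
    q ^ (m * a) / ∏ k ∈ Finset.range m, (1 + b * q ^ a * q ^ (k + 1)) with hg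
  have hqm : ‖q ^ m‖ < 1 := by
    rw [norm_pow]
    exact pow_lt_one₀ (norm_nonneg q) hq1 hm.ne'
  have hqm1 : 1 - q ^ m ≠ 0 := by
    intro h
    rw [← sub_eq_zero.mp h] at hqm
    simp at hqm
  obtain ⟨C, hC⟩ := exists_norm_inv_one_add_mul_pow_le (b := b) hq1
  have hs : Summable g := by
    refine Summable.of_norm_bounded
      ((summable_geometric_of_lt_one (norm_nonneg _) hqm).mul_right
        (∏ _k ∈ Finset.range m, C)) fun a => ?_
    simp only [hg]
    rw [div_eq_mul_inv, norm_mul, pow_mul, norm_pow]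
    refine mul_le_mul_of_nonneg_left ?_ (by positivity)
    rw [← Finset.prod_inv_distrib, norm_prod]
    refine Finset.prod_le_prod (fun _ _ => norm_nonneg _) fun k _ => ?_
    rw [mul_assoc, ← pow_add]
    exact hC _
  have ht : HasSum (fun a => g a - g (a + 1)) (g 0) := by
    simpa using hs.hasSum.sub ((hasSum_nat_add_iff' 1).mpr hs.hasSum)
  have h0 : 1 / ((1 - q ^ m) * ∏ k ∈ Finset.range m, (1 + b * q ^ (k + 1))) =
      g 0 / (1 - q ^ m) := by
    simp [hg, div_eq_mul_inv, mul_comm]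
  rw [h0]
  suffices h : (fun a : ℕ =>
      q ^ (m * a) / ∏ k ∈ Finset.range (m + 1), (1 + b * q ^ a * q ^ (k + 1))) =
      fun a => (g a - g (a + 1)) / (1 - q ^ m) by
    rw [h]
    exact ht.div_const _
  ext a
  have hne (k : ℕ) : 1 + b * q ^ a * q ^ (k + 1) ≠ 0 :=
    one_add_mul_pow_mul_pow_ne_zero hb a k.succ_pos
  have h1 := Finset.prod_range_succ (fun k => 1 + b * q ^ a * q ^ (k + 1)) m
  have h2 := Finset.prod_range_succ' (fun k => 1 + b * q ^ a * q ^ (k + 1)) m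
  have h3 : ∏ k ∈ Finset.range m, (1 + b * q ^ (a + 1) * q ^ (k + 1)) =
      ∏ k ∈ Finset.range m, (1 + b * q ^ a * q ^ (k + 1 + 1)) :=
    Finset.prod_congr rfl fun k _ => by ring
  simp only [hg, h3]
  have hP : ∏ k ∈ Finset.range m, (1 + b * q ^ a * q ^ (k + 1)) ≠ 0 :=
    Finset.prod_ne_zero_iff.mpr fun k _ => hne k
  have hQ : ∏ k ∈ Finset.range m, (1 + b * q ^ a * q ^ (k + 1 + 1)) ≠ 0 :=
    Finset.prod_ne_zero_iff.mpr fun k _ => hne (k + 1)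
  have hA := hne m
  have hB := hne 0
  rw [h1] at h2
  rw [h1]
  set P := ∏ k ∈ Finset.range m, (1 + b * q ^ a * q ^ (k + 1))
  set Q := ∏ k ∈ Finset.range m, (1 + b * q ^ a * q ^ (k + 1 + 1))
  have e1 : q ^ (m * (a + 1)) / Q =
      q ^ (m * a) * q ^ m * (1 + b * q ^ a * q ^ (0 + 1)) /
        (P * (1 + b * q ^ a * q ^ (m + 1))) := by
    rw [h2, mul_div_mul_right _ _ hB, Nat.mul_succ, pow_add]
  rw [e1]
  field_simp
  ring

theorem tsum_tupleTerm {q : ℂ} (hq1 : ‖q‖ < 1) {m : ℕ} (hm : 0 < m) (n : ℕ) (b : ℂ)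
    (hb : ∀ N : ℕ, 0 < N → 1 + b * q ^ N ≠ 0) :
    ∑' a : {a : Fin n → ℕ // Monotone a}, tupleTerm q b m n a.1 =
      1 / (qPoch (q ^ m) (q ^ m) n * qPoch (-(b * q)) q (m * n)) := by
  induction n generalizing b with
  | zero =>
    have : Unique {a : Fin 0 → ℕ // Monotone a} :=
      { default := ⟨Fin.elim0, fun i => i.elim0⟩
        uniq := fun _ => Subsingleton.elim _ _ }
    simp [tupleTerm, qPoch]
  | succ n ih =>
    have hs := (monotoneTupleConsEquiv n).summable_iff.mpr (summable_tupleTerm b hq1 hm (n + 1))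
    rw [← (monotoneTupleConsEquiv n).tsum_eq, Summable.tsum_prod (by exact hs)]
    have hmn : 0 < m * (n + 1) := by positivity
    have key (a : ℕ) : ∑' c : {a : Fin n → ℕ // Monotone a},
        tupleTerm q b m (n + 1) (monotoneTupleConsEquiv n (a, c)).1 =
        q ^ (m * (n + 1) * a) /
          (∏ k ∈ Finset.range (m * (n + 1) + 1), (1 + b * q ^ a * q ^ (k + 1))) *
            (1 / qPoch (q ^ m) (q ^ m) n) := by
      simp only [tupleTerm_cons]
      rw [tsum_mul_left, ih _ fun N hN => one_add_mul_pow_mul_pow_ne_zero hb _ hN, qPoch_neg_mul,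
        div_mul_div_comm, div_mul_div_comm, show m * (n + 1) + 1 = m + 1 + m * n by ring,
        Finset.prod_range_add _ (m + 1), mul_left_comm, mul_comm (qPoch _ _ _)]
      congr 2
      congr 1
      refine Finset.prod_congr rfl fun k _ => by ring
    simp only [key]
    rw [tsum_mul_right, (hasSum_pow_div_prod hq1 hb hmn).tsum_eq, qPoch_neg_mul,
      div_mul_div_comm, qPoch, qPoch, Finset.prod_range_succ, ← pow_mul, ← pow_add,
      show m + m * n = m * (n + 1) by ring]
    congr 1
    · ring
    · ring

/-- Lemma 3.1: for `0 < |q| < 1`, `b` with `1 + b q^N ≠ 0` for all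
positive integers `N`, and positive integers `m`, `n`, the sum over all weakly
increasing `n`-tuples `(a_1,…,a_n)` of nonnegative integers of
`q^{m(a_1+⋯+a_n)} / ∏_{j=1}^n ∏_{k=1}^{m+1} (1 + b q^{(j-1)(m+1)+k+a_j})`
converges absolutely and equals `1 / ((q^m; q^m)_n (−bq; q)_{mn})`. -/
theorem lemma_sum_one (q b : ℂ) (hq0 : 0 < ‖q‖) (hq1 : ‖q‖ < 1)
    (hb : ∀ N : ℕ, 0 < N → 1 + b * q ^ N ≠ 0) (m n : ℕ) (hm : 0 < m) (hn : 0 < n) :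
    Summable (fun a : {a : Fin n → ℕ // Monotone a} =>
      q ^ (m * ∑ j, a.1 j) /
        ∏ j : Fin n, ∏ k ∈ Finset.Icc 1 (m + 1),
          (1 + b * q ^ ((j : ℕ) * (m + 1) + k + a.1 j))) ∧
    ∑' a : {a : Fin n → ℕ // Monotone a},
      q ^ (m * ∑ j, a.1 j) /
        ∏ j : Fin n, ∏ k ∈ Finset.Icc 1 (m + 1),
          (1 + b * q ^ ((j : ℕ) * (m + 1) + k + a.1 j)) =
      1 / (qPoch (q ^ m) (q ^ m) n * qPoch (-(b * q)) q (m * n)) :=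
  ⟨summable_tupleTerm b hq1 hm n, tsum_tupleTerm hq1 hm n b hb⟩
end

section
/- Let q be a complex number with |q| < 1 and let a be a complex number with 1 + a q^{2N} ≠ 0 for every positive integer N. Then ∑_{n=0}^{∞} a^n q^{n²+n} / (q; q)_n = (−a q²; q²)_∞ · ∑_{n=0}^{∞} a^n q^{n²+2n} / ((q²; q²)_n · (−a q²; q²)_n). -/
open Filter Topology

lemma one_sub_pow_succ_ne_zero {p : ℂ} (hp : ‖p‖ < 1) (n : ℕ) : 1 - p ^ (n + 1) ≠ 0 := by
  intro h
  have h1 : ‖p ^ (n + 1)‖ = 1 := by rw [← sub_eq_zero.mp h, norm_one]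
  rw [norm_pow] at h1
  exact (pow_lt_one₀ (norm_nonneg p) hp n.succ_ne_zero).ne h1

lemma qPoch_zero (a q : ℂ) : qPoch a q 0 = 1 := by simp [qPoch]

lemma qPoch_self_succ (q : ℂ) (n : ℕ) : qPoch q q (n + 1) = qPoch q q n * (1 - q ^ (n + 1)) := by
  rw [qPoch_succ, pow_succ']

lemma qPoch_self_ne_zero {q : ℂ} (hq : ‖q‖ < 1) (n : ℕ) : qPoch q q n ≠ 0 := by
  induction n with
  | zero => simp [qPoch_zero]
  | succ n ih =>
    rw [qPoch_self_succ]
    exact mul_ne_zero ih (one_sub_pow_succ_ne_zero hq n)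

/-- The general term of Euler's expansion of `(-x; p)_∞`. -/
noncomputable def eulerTerm (p x : ℂ) (m : ℕ) : ℂ := x ^ m * p ^ m.choose 2 / qPoch p p m

lemma eulerTerm_succ_mul {p : ℂ} (hp : ‖p‖ < 1) (x : ℂ) (m : ℕ) :
    eulerTerm p x (m + 1) * (1 - p ^ (m + 1)) = x * p ^ m * eulerTerm p x m := by
  have h1 := one_sub_pow_succ_ne_zero hp m
  have h2 := qPoch_self_ne_zero hp m
  simp only [eulerTerm, qPoch_self_succ, Nat.choose_succ_succ' m 1, Nat.choose_one_right]
  field_simp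
  ring

lemma eulerTerm_mul_pow (p x : ℂ) (k m : ℕ) :
    eulerTerm p (x * p ^ k) m = (p ^ k) ^ m * eulerTerm p x m := by
  simp only [eulerTerm, mul_pow]
  ring

lemma norm_eulerTerm_mul_pow_le {p : ℂ} (hp : ‖p‖ < 1) (x : ℂ) (k m : ℕ) :
    ‖eulerTerm p (x * p ^ k) m‖ ≤ ‖eulerTerm p x m‖ := by
  rw [eulerTerm_mul_pow, norm_mul, norm_pow, norm_pow]
  exact mul_le_of_le_one_left (norm_nonneg _)
    (pow_le_one₀ (by positivity) (pow_le_one₀ (norm_nonneg p) hp.le))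

lemma summable_eulerTerm {p : ℂ} (hp : ‖p‖ < 1) (x : ℂ) : Summable (eulerTerm p x) := by
  have hpow : Tendsto (fun m : ℕ => p ^ m) atTop (𝓝 0) :=
    tendsto_pow_atTop_nhds_zero_of_norm_lt_one hp
  have hlim : Tendsto (fun m : ℕ => ‖x * p ^ m / (1 - p ^ (m + 1))‖) atTop (𝓝 0) := by
    have h := (hpow.const_mul x).div ((hpow.comp (tendsto_add_atTop_nat 1)).const_sub 1)
      (by simp)
    simpa using h.norm
  refine summable_of_ratio_norm_eventually_le (r := 1 / 2) (by norm_num) ?_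
  filter_upwards [hlim.eventually_le_const (show (0 : ℝ) < 1 / 2 by norm_num)] with m hm
  have h : eulerTerm p x (m + 1) = x * p ^ m / (1 - p ^ (m + 1)) * eulerTerm p x m := by
    rw [div_mul_eq_mul_div, eq_div_iff (one_sub_pow_succ_ne_zero hp m), eulerTerm_succ_mul hp]
  rw [h, norm_mul]
  exact mul_le_mul_of_nonneg_right hm (norm_nonneg _)

lemma tsum_eulerTerm_eq_one_add_mul {p : ℂ} (hp : ‖p‖ < 1) (x : ℂ) :
    ∑' m, eulerTerm p x m = (1 + x) * ∑' m, eulerTerm p (x * p) m := by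
  have hs := summable_eulerTerm hp x
  have hs' := summable_eulerTerm hp (x * p)
  have hp1 (m : ℕ) : eulerTerm p (x * p) m = p ^ m * eulerTerm p x m := by
    simpa using eulerTerm_mul_pow p x 1 m
  have h0 : eulerTerm p x 0 = eulerTerm p (x * p) 0 := by simp [eulerTerm]
  have hstep (m : ℕ) :
      eulerTerm p x (m + 1) = eulerTerm p (x * p) (m + 1) + x * eulerTerm p (x * p) m := by
    rw [hp1, hp1]
    linear_combination eulerTerm_succ_mul hp x m
  rw [hs.tsum_eq_zero_add, tsum_congr hstep,
    ((summable_nat_add_iff 1).mpr hs').tsum_add (hs'.mul_left x), tsum_mul_left, h0, ← add_assoc,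
    ← hs'.tsum_eq_zero_add]
  ring

lemma tsum_eulerTerm_eq_qPoch_mul {p : ℂ} (hp : ‖p‖ < 1) (x : ℂ) (n : ℕ) :
    ∑' m, eulerTerm p x m = qPoch (-x) p n * ∑' m, eulerTerm p (x * p ^ n) m := by
  induction n with
  | zero => simp [qPoch_zero]
  | succ n ih =>
    rw [ih, tsum_eulerTerm_eq_one_add_mul hp (x * p ^ n), qPoch_succ, mul_assoc x, ← pow_succ]
    ring

lemma multipliable_one_sub_mul_pow {q : ℂ} (hq : ‖q‖ < 1) (a : ℂ) :
    Multipliable fun j : ℕ => 1 - a * q ^ j := by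
  have h : Summable fun j : ℕ => ‖-(a * q ^ j)‖ := by
    simpa using (summable_geometric_of_lt_one (norm_nonneg q) hq).mul_left ‖a‖
  simpa [sub_eq_add_neg] using multipliable_one_add_of_summable h

/-- Euler's expansion of the infinite `q`-Pochhammer symbol. -/
theorem tsum_eulerTerm {p : ℂ} (hp : ‖p‖ < 1) (x : ℂ) :
    ∑' m, eulerTerm p x m = qPochInf (-x) p := by
  have hprod : Tendsto (qPoch (-x) p) atTop (𝓝 (qPochInf (-x) p)) :=
    (multipliable_one_sub_mul_pow hp (-x)).hasProd.tendsto_prod_nat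
  have harg : Tendsto (fun n : ℕ => x * p ^ n) atTop (𝓝 0) := by
    simpa using (tendsto_pow_atTop_nhds_zero_of_norm_lt_one hp).const_mul x
  have hsum : Tendsto (fun n : ℕ => ∑' m, eulerTerm p (x * p ^ n) m) atTop
      (𝓝 (∑' m, eulerTerm p 0 m)) := by
    refine tendsto_tsum_of_dominated_convergence (summable_eulerTerm hp x).norm (fun m => ?_)
      (Eventually.of_forall fun n m => norm_eulerTerm_mul_pow_le hp x n m)
    exact ((harg.pow m).mul_const _).div_const _
  have hzero : ∑' m, eulerTerm p 0 m = 1 := by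
    rw [tsum_eq_single 0 fun m hm => by simp [eulerTerm, hm]]
    simp [eulerTerm, qPoch_zero]
  rw [hzero] at hsum
  refine tendsto_nhds_unique ?_ (by simpa using hprod.mul hsum)
  exact tendsto_const_nhds.congr fun n => tsum_eulerTerm_eq_qPoch_mul hp x n

/-- The `q`-binomial convolution `∑_{n+m=N} q^n / ((q²; q²)_n (q²; q²)_m) = 1 / (q; q)_N`. -/
lemma sum_antidiagonal_pow_div_qPoch_sq {q : ℂ} (hq : ‖q‖ < 1) (N : ℕ) :
    ∑ k ∈ Finset.HasAntidiagonal.antidiagonal N,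
      q ^ k.1 / (qPoch (q ^ 2) (q ^ 2) k.1 * qPoch (q ^ 2) (q ^ 2) k.2) = 1 / qPoch q q N := by
  have hq2 : ‖q ^ 2‖ < 1 := by
    rw [norm_pow]
    exact pow_lt_one₀ (norm_nonneg q) hq two_ne_zero
  induction N with
  | zero => simp [qPoch_zero]
  | succ N ih =>
    set c : ℕ → ℂ := fun n => (qPoch (q ^ 2) (q ^ 2) n)⁻¹ with hc
    have hcstep (n : ℕ) : c (n + 1) = c n + (q ^ 2) ^ (n + 1) * c (n + 1) := by
      have h1 := one_sub_pow_succ_ne_zero hq2 n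
      have h2 := qPoch_self_ne_zero hq2 n
      simp only [hc, qPoch_self_succ]
      field_simp
      ring
    have hterm (k : ℕ × ℕ) :
        q ^ k.1 / (qPoch (q ^ 2) (q ^ 2) k.1 * qPoch (q ^ 2) (q ^ 2) k.2) =
          q ^ k.1 * c k.1 * c k.2 := by
      simp only [hc, div_eq_mul_inv, mul_inv, mul_assoc]
    simp only [hterm] at ih ⊢
    have hswap : ∑ k ∈ Finset.HasAntidiagonal.antidiagonal (N + 1), q ^ k.1 * c k.1 * ((q ^ 2) ^ k.2 * c k.2) =
        q ^ (N + 1) * ∑ k ∈ Finset.HasAntidiagonal.antidiagonal (N + 1), q ^ k.1 * c k.1 * c k.2 := by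
      rw [← Finset.Nat.sum_antidiagonal_swap, Finset.mul_sum]
      refine Finset.sum_congr rfl fun k hk => ?_
      rw [← Finset.HasAntidiagonal.mem_antidiagonal.mp hk]
      simp only [Prod.fst_swap, Prod.snd_swap]
      ring
    have hrec : ∑ k ∈ Finset.HasAntidiagonal.antidiagonal (N + 1), q ^ k.1 * c k.1 * c k.2 =
        ∑ k ∈ Finset.HasAntidiagonal.antidiagonal N, q ^ k.1 * c k.1 * c k.2 +
          q ^ (N + 1) * ∑ k ∈ Finset.HasAntidiagonal.antidiagonal (N + 1), q ^ k.1 * c k.1 * c k.2 := by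
      rw [← hswap, Finset.Nat.sum_antidiagonal_succ', Finset.Nat.sum_antidiagonal_succ',
        add_left_comm, ← Finset.sum_add_distrib]
      congr 1
      · simp
      · refine Finset.sum_congr rfl fun k _ => ?_
        linear_combination q ^ k.1 * c k.1 * hcstep k.2
    have h1 := one_sub_pow_succ_ne_zero hq N
    have h2 := qPoch_self_ne_zero hq N
    rw [ih] at hrec
    rw [qPoch_self_succ, ← div_div, eq_div_iff h1]
    linear_combination hrec

lemma eulerTerm_sq (q a : ℂ) (k m : ℕ) :
    eulerTerm (q ^ 2) (a * q ^ (k + 1)) m =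
      a ^ m * q ^ (m ^ 2 + k * m) / qPoch (q ^ 2) (q ^ 2) m := by
  have h : m ^ 2 = 2 * m.choose 2 + m := by
    induction m with
    | zero => rfl
    | succ m ih =>
      rw [Nat.choose_succ_succ' m 1, Nat.choose_one_right]
      linarith
  rw [eulerTerm, h]
  ring


/-- first identity of Entry 1.5.1: for `|q| < 1` and `a` with
`1 + a q^{2N} ≠ 0` for all positive integers `N`,
`∑_{n≥0} a^n q^{n²+n}/(q; q)_n
  = (−aq²; q²)_∞ ∑_{n≥0} a^n q^{n²+2n}/((q²; q²)_n (−aq²; q²)_n)`. -/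
theorem entry_1_5_1_first (q a : ℂ) (hq : ‖q‖ < 1)
    (ha : ∀ N : ℕ, 0 < N → 1 + a * q ^ (2 * N) ≠ 0) :
    ∑' n : ℕ, a ^ n * q ^ (n ^ 2 + n) / qPoch q q n =
      qPochInf (-(a * q ^ 2)) (q ^ 2) *
        ∑' n : ℕ, a ^ n * q ^ (n ^ 2 + 2 * n) /
          (qPoch (q ^ 2) (q ^ 2) n * qPoch (-(a * q ^ 2)) (q ^ 2) n) := by
  have hq2 : ‖q ^ 2‖ < 1 := by
    rw [norm_pow]
    exact pow_lt_one₀ (norm_nonneg q) hq two_ne_zero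
  have hne (n : ℕ) : qPoch (-(a * q ^ 2)) (q ^ 2) n ≠ 0 := by
    refine Finset.prod_ne_zero_iff.mpr fun j _ => ?_
    convert ha (j + 1) j.succ_pos using 1
    ring
  set F : ℕ × ℕ → ℂ := fun k =>
    eulerTerm (q ^ 2) (a * q ^ 3) k.1 * eulerTerm (q ^ 2) (a * q ^ 2 * (q ^ 2) ^ k.1) k.2 with hF
  have hFs : Summable F := by
    refine Summable.of_norm_bounded
      ((summable_eulerTerm hq2 (a * q ^ 3)).norm.mul_of_nonneg
        (summable_eulerTerm hq2 (a * q ^ 2)).norm (fun _ => norm_nonneg _)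
        fun _ => norm_nonneg _) fun k => ?_
    rw [hF, norm_mul]
    exact mul_le_mul_of_nonneg_left (norm_eulerTerm_mul_pow_le hq2 _ _ _) (norm_nonneg _)
  have hright : qPochInf (-(a * q ^ 2)) (q ^ 2) *
        ∑' n : ℕ, a ^ n * q ^ (n ^ 2 + 2 * n) /
          (qPoch (q ^ 2) (q ^ 2) n * qPoch (-(a * q ^ 2)) (q ^ 2) n) = ∑' k, F k := by
    rw [hFs.tsum_prod, ← tsum_mul_left]
    refine tsum_congr fun n => ?_
    simp only [hF]
    rw [tsum_mul_left, ← tsum_eulerTerm hq2, tsum_eulerTerm_eq_qPoch_mul hq2 _ n,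
      eulerTerm_sq q a 2 n]
    have h1 := hne n
    have h2 := qPoch_self_ne_zero hq2 n
    field_simp
  rw [hright, ← Finset.HasAntidiagonal.sigmaAntidiagonalEquivProd.tsum_eq F]
  refine Eq.trans (tsum_congr fun N => ?_)
    (Finset.HasAntidiagonal.sigmaAntidiagonalEquivProd.summable_iff.mpr hFs).tsum_sigma.symm
  simp only [Function.comp_apply, Finset.HasAntidiagonal.sigmaAntidiagonalEquivProd_apply]
  rw [tsum_fintype, Finset.univ_eq_attach,
    Finset.sum_attach (Finset.HasAntidiagonal.antidiagonal N) (fun k => F k), div_eq_mul_one_div,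
    ← sum_antidiagonal_pow_div_qPoch_sq hq, Finset.mul_sum]
  refine Finset.sum_congr rfl fun k hk => ?_
  rw [← Finset.HasAntidiagonal.mem_antidiagonal.mp hk]
  simp only [hF, eulerTerm_mul_pow, eulerTerm_sq q a 2, eulerTerm_sq q a 1]
  ring
end
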